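/- Let (Ξ,Θ,Γ) be a G-complete fuzzy metric space whose t-norm Γ is of H-type and such that lim_{ρ→∞} Θ(u,v,ρ) = 1 for all u,v ∈ Ξ. If f : Ξ → Ξ is a contraction mapping, i.e., there exists k ∈ (0,1) such that Θ(f u, f v, k ρ) ≥ Θ(u,v,ρ) for all u,v ∈ Ξ and ρ > 0, then f possesses a unique fixed point. -/

import Mathlib

open Filter Topology

/-- A fuzzy metric space in the sense of George and Veeramani:
`Θ : Ξ × Ξ × (0,∞) → (0,1]` together with a continuous t-norm `Γ` on `[0,1]`. -/
structure FuzzyMetricSpace (Ξ : Type*) where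
  Θ : Ξ → Ξ → ℝ → ℝ
  Γ : ℝ → ℝ → ℝ
  Γ_comm : ∀ a b, Γ a b = Γ b a
  Γ_assoc : ∀ a b c, Γ (Γ a b) c = Γ a (Γ b c)
  Γ_mono : ∀ a ∈ Set.Icc (0:ℝ) 1, ∀ b ∈ Set.Icc (0:ℝ) 1, ∀ c ∈ Set.Icc (0:ℝ) 1,
    b ≤ c → Γ a b ≤ Γ a c
  Γ_one : ∀ a ∈ Set.Icc (0:ℝ) 1, Γ a 1 = a
  Γ_mem : ∀ a ∈ Set.Icc (0:ℝ) 1, ∀ b ∈ Set.Icc (0:ℝ) 1, Γ a b ∈ Set.Icc (0:ℝ) 1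
  Γ_cont : ContinuousOn (fun p : ℝ × ℝ => Γ p.1 p.2) (Set.Icc 0 1 ×ˢ Set.Icc 0 1)
  Θ_pos : ∀ u v ρ, 0 < ρ → 0 < Θ u v ρ
  Θ_le_one : ∀ u v ρ, 0 < ρ → Θ u v ρ ≤ 1
  Θ_eq_one_iff : ∀ u v ρ, 0 < ρ → (Θ u v ρ = 1 ↔ u = v)
  Θ_symm : ∀ u v ρ, Θ u v ρ = Θ v u ρ
  Θ_tri : ∀ u v z ρ s, 0 < ρ → 0 < s → Γ (Θ u v ρ) (Θ v z s) ≤ Θ u z (ρ + s)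
  Θ_cont : ∀ u v, ContinuousOn (Θ u v) (Set.Ioi 0)

variable {Ξ : Type*}

/-- Convergence of a sequence in a fuzzy metric space. -/
def FuzzyMetricSpace.Converges (F : FuzzyMetricSpace Ξ) (u : ℕ → Ξ) (x : Ξ) : Prop :=
  ∀ ε ∈ Set.Ioo (0:ℝ) 1, ∀ ρ > (0:ℝ), ∃ N : ℕ, ∀ n ≥ N, 1 - ε < F.Θ (u n) x ρ

/-- G-Cauchy sequences in a fuzzy metric space. -/
def FuzzyMetricSpace.GCauchy (F : FuzzyMetricSpace Ξ) (u : ℕ → Ξ) : Prop :=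
  ∀ p : ℕ, 0 < p → ∀ ε ∈ Set.Ioo (0:ℝ) 1, ∀ ρ > (0:ℝ),
    ∃ N : ℕ, ∀ n ≥ N, 1 - ε < F.Θ (u n) (u (n + p)) ρ

/-- G-completeness: every G-Cauchy sequence converges. -/
def FuzzyMetricSpace.GComplete (F : FuzzyMetricSpace Ξ) : Prop :=
  ∀ u : ℕ → Ξ, F.GCauchy u → ∃ x : Ξ, F.Converges u x

/-- Iterates of a t-norm: `Γ^0(a) = 1`, `Γ^{n+1}(a) = Γ(Γ^n(a), a)`. -/
def tnormIter (Γ : ℝ → ℝ → ℝ) : ℕ → ℝ → ℝ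
  | 0, _ => 1
  | n + 1, a => Γ (tnormIter Γ n a) a

/-- A t-norm of H-type. -/
def FuzzyMetricSpace.HType (F : FuzzyMetricSpace Ξ) : Prop :=
  ∀ ε ∈ Set.Ioo (0:ℝ) 1, ∃ lam ∈ Set.Ioo (0:ℝ) 1,
    ∀ ρ ∈ Set.Icc (0:ℝ) 1, 1 - lam < ρ → ∀ n : ℕ, 1 ≤ n → 1 - ε < tnormIter F.Γ n ρ

/-- The class `Π` of functions `ζ : (0,∞) → (0,∞)` whose iterates tend to `0`. -/
def MemPi (ζ : ℝ → ℝ) : Prop :=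
  (∀ ρ > (0:ℝ), 0 < ζ ρ) ∧ ∀ ρ > (0:ℝ), Tendsto (fun n : ℕ => ζ^[n] ρ) atTop (nhds 0)

namespace FuzzyMetricSpace

theorem Θ_mem_Icc (F : FuzzyMetricSpace Ξ) (u v : Ξ) {ρ : ℝ} (hρ : 0 < ρ) :
    F.Θ u v ρ ∈ Set.Icc (0:ℝ) 1 :=
  ⟨(F.Θ_pos u v ρ hρ).le, F.Θ_le_one u v ρ hρ⟩

theorem Θ_div_pow_le_iterate (F : FuzzyMetricSpace Ξ) {k : ℝ} (hk : 0 < k) {f : Ξ → Ξ}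
    (hf : ∀ u v : Ξ, ∀ ρ > (0:ℝ), F.Θ u v ρ ≤ F.Θ (f u) (f v) (k * ρ))
    (u v : Ξ) {ρ : ℝ} (hρ : 0 < ρ) (n : ℕ) :
    F.Θ u v (ρ / k ^ n) ≤ F.Θ (f^[n] u) (f^[n] v) ρ := by
  induction n generalizing u v with
  | zero => simp
  | succ n ih =>
    refine le_trans ?_ (ih (f u) (f v))
    have h := hf u v (ρ / k ^ (n + 1)) (by positivity)
    rwa [show k * (ρ / k ^ (n + 1)) = ρ / k ^ n by rw [pow_succ]; field_simp] at h

theorem tendsto_Θ_div_pow (F : FuzzyMetricSpace Ξ) {k : ℝ} (hk : k ∈ Set.Ioo (0:ℝ) 1)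
    {u v : Ξ} (hlim : Tendsto (fun ρ => F.Θ u v ρ) atTop (𝓝 1)) {ρ : ℝ} (hρ : 0 < ρ) :
    Tendsto (fun n : ℕ => F.Θ u v (ρ / k ^ n)) atTop (𝓝 1) := by
  refine hlim.comp ?_
  have h := (tendsto_pow_atTop_atTop_of_one_lt ((one_lt_inv₀ hk.1).2 hk.2)).const_mul_atTop hρ
  simpa only [inv_pow, div_eq_mul_inv] using h

theorem Converges.tendsto {F : FuzzyMetricSpace Ξ} {u : ℕ → Ξ} {x : Ξ} (h : F.Converges u x)
    {ρ : ℝ} (hρ : 0 < ρ) : Tendsto (fun n => F.Θ (u n) x ρ) atTop (𝓝 1) := by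
  refine tendsto_order.2 ⟨fun a ha => ?_, fun a ha =>
    Eventually.of_forall fun n => (F.Θ_le_one _ _ _ hρ).trans_lt ha⟩
  obtain ⟨N, hN⟩ := h (min (1 - a) (1 / 2))
    ⟨lt_min (sub_pos.2 ha) (by norm_num), (min_le_right _ _).trans_lt (by norm_num)⟩ ρ hρ
  filter_upwards [eventually_ge_atTop N] with n hn
  linarith [hN n hn, min_le_left (1 - a) (1 / 2)]

theorem tendsto_Γ_one (F : FuzzyMetricSpace Ξ) {a b : ℕ → ℝ}
    (ha : ∀ n, a n ∈ Set.Icc (0:ℝ) 1) (hb : ∀ n, b n ∈ Set.Icc (0:ℝ) 1)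
    (ha1 : Tendsto a atTop (𝓝 1)) (hb1 : Tendsto b atTop (𝓝 1)) :
    Tendsto (fun n => F.Γ (a n) (b n)) atTop (𝓝 1) := by
  have h1 : (1:ℝ) ∈ Set.Icc (0:ℝ) 1 := ⟨zero_le_one, le_rfl⟩
  have hc := F.Γ_cont (1, 1) ⟨h1, h1⟩
  have h := hc.tendsto.comp (tendsto_nhdsWithin_iff.2
    ⟨ha1.prodMk_nhds hb1, Eventually.of_forall fun n => ⟨ha n, hb n⟩⟩)
  simpa only [F.Γ_one 1 h1, Function.comp_def] using h

theorem gCauchy_iterate (F : FuzzyMetricSpace Ξ)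
    (hlim : ∀ u v : Ξ, Tendsto (fun ρ => F.Θ u v ρ) atTop (𝓝 1))
    {k : ℝ} (hk : k ∈ Set.Ioo (0:ℝ) 1) {f : Ξ → Ξ}
    (hf : ∀ u v : Ξ, ∀ ρ > (0:ℝ), F.Θ u v ρ ≤ F.Θ (f u) (f v) (k * ρ)) (x : Ξ) :
    F.GCauchy fun n => f^[n] x := by
  intro p _ ε hε ρ hρ
  obtain ⟨N, hN⟩ := eventually_atTop.1 ((F.tendsto_Θ_div_pow hk (hlim x (f^[p] x)) hρ).eventually
    (lt_mem_nhds (sub_lt_self 1 hε.1)))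
  refine ⟨N, fun n hn => (hN n hn).trans_le ?_⟩
  simpa only [Function.iterate_add_apply] using
    F.Θ_div_pow_le_iterate hk.1 hf x (f^[p] x) hρ n

theorem Converges.isFixedPt {F : FuzzyMetricSpace Ξ} {k : ℝ} (hk : 0 < k) {f : Ξ → Ξ}
    (hf : ∀ u v : Ξ, ∀ ρ > (0:ℝ), F.Θ u v ρ ≤ F.Θ (f u) (f v) (k * ρ)) {x z : Ξ}
    (hz : F.Converges (fun n => f^[n] x) z) : f z = z := by
  have hk2 : 0 < k⁻¹ := inv_pos.2 hk
  have hΓ := F.tendsto_Γ_one (a := fun n => F.Θ (f z) (f^[n + 1] x) 1)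
    (fun n => F.Θ_mem_Icc _ _ one_pos) (fun n => F.Θ_mem_Icc _ _ one_pos)
    (tendsto_of_tendsto_of_tendsto_of_le_of_le (hz.tendsto hk2) tendsto_const_nhds
      (fun n => ?_) (fun n => F.Θ_le_one _ _ _ one_pos))
    ((tendsto_add_atTop_iff_nat 1).2 (hz.tendsto one_pos))
  · refine (F.Θ_eq_one_iff (f z) z (1 + 1) (by norm_num)).1
      (le_antisymm (F.Θ_le_one _ _ _ (by norm_num)) ?_)
    exact le_of_tendsto' hΓ fun n => F.Θ_tri _ _ _ _ _ one_pos one_pos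
  · have h := hf (f^[n] x) z k⁻¹ hk2
    rwa [mul_inv_cancel₀ hk.ne', ← Function.iterate_succ_apply' f, F.Θ_symm _ (f z)] at h

theorem eq_of_isFixedPt (F : FuzzyMetricSpace Ξ) {k : ℝ} (hk : k ∈ Set.Ioo (0:ℝ) 1) {f : Ξ → Ξ}
    (hf : ∀ u v : Ξ, ∀ ρ > (0:ℝ), F.Θ u v ρ ≤ F.Θ (f u) (f v) (k * ρ)) {z w : Ξ}
    (hlim : Tendsto (fun ρ => F.Θ z w ρ) atTop (𝓝 1)) (hz : f z = z) (hw : f w = w) :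
    z = w := by
  refine (F.Θ_eq_one_iff z w 1 one_pos).1 (le_antisymm (F.Θ_le_one _ _ _ one_pos) ?_)
  refine le_of_tendsto' (F.tendsto_Θ_div_pow hk hlim one_pos) fun n => ?_
  simpa only [Function.iterate_fixed hz, Function.iterate_fixed hw] using
    F.Θ_div_pow_le_iterate hk.1 hf z w one_pos n

end FuzzyMetricSpace

/-- Grabiec's fixed point theorem as a corollary. -/
theorem grabiec_fixed_point
    {Ξ : Type*} [Nonempty Ξ] (F : FuzzyMetricSpace Ξ)
    (hcomp : F.GComplete) (hH : F.HType)
    (hlim : ∀ u v : Ξ, Tendsto (fun ρ => F.Θ u v ρ) atTop (nhds 1))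
    (k : ℝ) (hk : k ∈ Set.Ioo (0:ℝ) 1) (f : Ξ → Ξ)
    (hf : ∀ u v : Ξ, ∀ ρ > (0:ℝ), F.Θ u v ρ ≤ F.Θ (f u) (f v) (k * ρ)) :
    ∃! z : Ξ, f z = z := by
  obtain ⟨x⟩ := ‹Nonempty Ξ›
  obtain ⟨z, hz⟩ := hcomp _ (F.gCauchy_iterate hlim hk hf x)
  have hfz := hz.isFixedPt hk.1 hf
  exact ⟨z, hfz, fun w hw => F.eq_of_isFixedPt hk hf (hlim w z) hw hfz⟩
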